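/- (Theorem 3: correctness of the joint averaged capital test under arbitrary adaptive sampling.) Let W ≥ 1, let m ∈ [0,1]^W, and let (F_t)_{t∈ℕ} be a filtration on a probability space. For each t ≥ 1 let A_t (taking values in {1, …, W}) and X_t (taking values in [0,1]) be F_t-measurable, and for each arm a let Ĥ_t(a) be an F_{t−1}-measurable [0,1]-valued random variable. Assume that for each t ≥ 1 and each arm a, E[ 1{A_t = a}·(X_t − m_a) | F_{t−1} ] = 0 almost surely. Let c ≥ 1/4, define for each arm a the process K_t^a = ∏_{i=1}^t ( 1 − 1{A_i = a} + 1{A_i = a}·(1 + (Ĥ_i(a) − m_a)(X_i − m_a)/c) ), and set E_t(m) = (1/W)·∑_{a=1}^W K_t^a. Then (E_t(m))_{t∈ℕ} is a nonnegative martingale with E_0(m) = 1, and for every α ∈ (0,1), P(∃ t ∈ ℕ : E_t(m) ≥ 1/α) ≤ α. -/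

import Mathlib

open MeasureTheory Finset

namespace MeasureTheory

/-- **Ville's inequality** for nonnegative martingales. -/
theorem Martingale.measure_exists_ge_le {Ω : Type*} {mΩ : MeasurableSpace Ω} {P : Measure Ω}
    [IsFiniteMeasure P] {ℱ : Filtration ℕ mΩ} {f : ℕ → Ω → ℝ} (hf : Martingale f ℱ P)
    (hnonneg : ∀ t ω, 0 ≤ f t ω) {ε : ℝ} (hε : 0 < ε) :
    P {ω | ∃ t, ε ≤ f t ω} ≤ ENNReal.ofReal ((∫ ω, f 0 ω ∂P) / ε) := by
  have hset : {ω | ∃ t, ε ≤ f t ω} = ⋃ n, {ω | ∃ t ≤ n, ε ≤ f t ω} := by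
    ext ω
    simp only [Set.mem_ofPred_eq, Set.mem_iUnion]
    exact ⟨fun ⟨t, ht⟩ ↦ ⟨t, t, le_rfl, ht⟩, fun ⟨_, t, _, ht⟩ ↦ ⟨t, ht⟩⟩
  have hmono : Monotone fun n : ℕ ↦ {ω | ∃ t ≤ n, ε ≤ f t ω} :=
    fun i j hij ω ⟨t, hti, ht⟩ ↦ ⟨t, hti.trans hij, ht⟩
  rw [hset, hmono.measure_iUnion]
  refine iSup_le fun n ↦ ?_
  have hmax := maximal_ineq hf.submartingale hnonneg (ε := ε.toNNReal) n
  have hsup : {ω | ∃ t ≤ n, ε ≤ f t ω} = {ω | (ε.toNNReal : ℝ) ≤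
      (Finset.range (n + 1)).sup' Finset.nonempty_range_add_one fun k ↦ f k ω} := by
    ext ω
    simp [Finset.le_sup'_iff, hε.le]
  rw [← hsup] at hmax
  have hint : ∫ ω in {ω | ∃ t ≤ n, ε ≤ f t ω}, f n ω ∂P ≤ ∫ ω, f 0 ω ∂P := by
    have heq := hf.setIntegral_eq (Nat.zero_le n) MeasurableSet.univ
    rw [setIntegral_univ, setIntegral_univ] at heq
    rw [heq]
    exact setIntegral_le_integral (hf.integrable n) (ae_of_all _ (hnonneg n))
  rw [ENNReal.ofReal_div_of_pos hε, ENNReal.le_div_iff_mul_le (by simp [hε]) (by simp), mul_comm]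
  exact hmax.trans (ENNReal.ofReal_le_ofReal hint)

/-- Wealth accumulated by betting on bounded martingale differences is a martingale. -/
theorem martingale_prod_one_add {Ω : Type*} {mΩ : MeasurableSpace Ω} {P : Measure Ω}
    [IsFiniteMeasure P] {ℱ : Filtration ℕ mΩ} {D : ℕ → Ω → ℝ} {C : ℝ}
    (hD : ∀ i, StronglyMeasurable[ℱ (i + 1)] (D i)) (hbound : ∀ i ω, |D i ω| ≤ C)
    (hcond : ∀ i, P[D i | ℱ i] =ᵐ[P] 0) :
    Martingale (fun t ω ↦ ∏ i ∈ Finset.range t, (1 + D i ω)) ℱ P := by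
  have hadp : StronglyAdapted ℱ fun t ω ↦ ∏ i ∈ Finset.range t, (1 + D i ω) := fun t ↦
    Finset.stronglyMeasurable_fun_prod _ fun i hi ↦ stronglyMeasurable_const.add
      ((hD i).mono (ℱ.mono (Nat.succ_le_of_lt (Finset.mem_range.mp hi))))
  have hint : ∀ t, Integrable (fun ω ↦ ∏ i ∈ Finset.range t, (1 + D i ω)) P := by
    refine fun t ↦ .of_bound ((hadp t).mono (ℱ.le t)).aestronglyMeasurable ((1 + C) ^ t)
      (ae_of_all _ fun ω ↦ ?_)
    rw [norm_prod]
    calc ∏ i ∈ Finset.range t, ‖1 + D i ω‖ ≤ ∏ _i ∈ Finset.range t, (1 + C) :=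
          Finset.prod_le_prod (fun _ _ ↦ norm_nonneg _) fun i _ ↦
            (norm_add_le _ _).trans (by simpa using hbound i ω)
      _ = (1 + C) ^ t := by simp
  refine martingale_of_condExp_sub_eq_zero_nat hadp hint fun t ↦ ?_
  have hsub : (fun ω ↦ ∏ i ∈ Finset.range (t + 1), (1 + D i ω))
      - (fun ω ↦ ∏ i ∈ Finset.range t, (1 + D i ω))
      = (fun ω ↦ ∏ i ∈ Finset.range t, (1 + D i ω)) * D t := by
    ext ω
    simp only [Pi.sub_apply, Pi.mul_apply, Finset.prod_range_succ]
    ring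
  have hDint : Integrable (D t) P :=
    .of_bound ((hD t).mono (ℱ.le _)).aestronglyMeasurable C (ae_of_all _ (hbound t))
  rw [hsub]
  refine (condExp_mul_of_stronglyMeasurable_left (hadp t)
    (hsub ▸ (hint (t + 1)).sub (hint t)) hDint).trans ?_
  filter_upwards [hcond t] with ω hω
  simp [hω]

end MeasureTheory

/-- The product of two deviations of points of `[0, 1]` from `m ∈ [0, 1]` is at least `-1/4`. -/
theorem neg_quarter_le_sub_mul_sub {h x m : ℝ} (hh : h ∈ Set.Icc (0 : ℝ) 1)
    (hx : x ∈ Set.Icc (0 : ℝ) 1) (hm : m ∈ Set.Icc (0 : ℝ) 1) :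
    -(1 / 4) ≤ (h - m) * (x - m) := by
  obtain ⟨hh0, hh1⟩ := hh
  obtain ⟨hx0, hx1⟩ := hx
  obtain ⟨hm0, hm1⟩ := hm
  rcases le_total h m with h1 | h1 <;> rcases le_total x m with h2 | h2 <;>
    nlinarith [sq_nonneg (2 * m - 1), mul_nonneg hh0 (sub_nonneg.2 h2),
      mul_nonneg hx0 (sub_nonneg.2 h1), mul_nonneg (sub_nonneg.2 h1) (sub_nonneg.2 h2),
      mul_nonneg (sub_nonneg.2 hh1) (sub_nonneg.2 h2),
      mul_nonneg (sub_nonneg.2 hx1) (sub_nonneg.2 h1), mul_nonneg hm0 (sub_nonneg.2 hx1),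
      mul_nonneg hm0 (sub_nonneg.2 hh1)]

/-- **Theorem 3: correctness of the joint averaged capital test under
arbitrary adaptive sampling.** Here `A i, X i` play the roles of `A_{i+1}, X_{i+1}`
(measurable w.r.t. `ℱ (i+1)`), `H i a` plays the role of `Ĥ_{i+1}(a)` (which is
`ℱ i`-measurable), and for each arm `a`,
`K^a_t = ∏_{i<t} (1 − 1{A_i = a} + 1{A_i = a}(1 + (Ĥ_i(a) − m_a)(X_i − m_a)/c))`,
`E_t(m) = (1/W) ∑_a K^a_t`.  Then `E` is a nonnegative martingale starting at `1`,
and for every `α ∈ (0,1)`, `P(∃ t : E_t(m) ≥ 1/α) ≤ α`. -/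
theorem joint_capital_process_type_one_error
    {Ω : Type*} {mΩ : MeasurableSpace Ω} {P : Measure Ω} [IsProbabilityMeasure P]
    (W : ℕ) (hW : 1 ≤ W)
    (m : Fin W → ℝ) (hm : ∀ a, m a ∈ Set.Icc (0 : ℝ) 1)
    (ℱ : Filtration ℕ mΩ)
    (A : ℕ → Ω → Fin W) (X : ℕ → Ω → ℝ) (H : ℕ → Fin W → Ω → ℝ)
    (hAmeas : ∀ i, Measurable[ℱ (i + 1)] (A i))
    (hXmeas : ∀ i, StronglyMeasurable[ℱ (i + 1)] (X i))
    (hXval : ∀ i ω, X i ω ∈ Set.Icc (0 : ℝ) 1)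
    (hXint : ∀ i, Integrable (X i) P)
    (hHmeas : ∀ i a, StronglyMeasurable[ℱ i] (H i a))
    (hHval : ∀ i a ω, H i a ω ∈ Set.Icc (0 : ℝ) 1)
    (hcond : ∀ i a,
      P[fun ω => (if A i ω = a then (1 : ℝ) else 0) * (X i ω - m a) | ℱ i]
        =ᵐ[P] fun _ => (0 : ℝ))
    (c : ℝ) (hc : 1 / 4 ≤ c)
    (K : Fin W → ℕ → Ω → ℝ)
    (hK : ∀ a t ω, K a t ω = ∏ i ∈ Finset.range t,
      (1 - (if A i ω = a then (1 : ℝ) else 0)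
        + (if A i ω = a then (1 : ℝ) else 0)
          * (1 + (H i a ω - m a) * (X i ω - m a) / c)))
    (E : ℕ → Ω → ℝ)
    (hE : ∀ t ω, E t ω = (1 / (W : ℝ)) * ∑ a : Fin W, K a t ω) :
    Martingale E ℱ P ∧ (∀ t ω, 0 ≤ E t ω) ∧ (∀ ω, E 0 ω = 1) ∧
      ∀ α : ℝ, α ∈ Set.Ioo (0 : ℝ) 1 →
        P {ω | ∃ t : ℕ, E t ω ≥ 1 / α} ≤ ENNReal.ofReal α := by
  have hc0 : 0 < c := by linarith
  set D : Fin W → ℕ → Ω → ℝ := fun a i ω ↦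
    (H i a ω - m a) / c * ((if A i ω = a then (1 : ℝ) else 0) * (X i ω - m a)) with hDdef
  have hKD : ∀ a t ω, K a t ω = ∏ i ∈ Finset.range t, (1 + D a i ω) := fun a t ω ↦ by
    rw [hK]
    exact Finset.prod_congr rfl fun i _ ↦ by simp only [hDdef]; ring
  have hdev : ∀ a x, x ∈ Set.Icc (0 : ℝ) 1 → |x - m a| ≤ 1 := fun a x hx ↦
    abs_sub_le_iff.2 ⟨by linarith [hx.2, (hm a).1], by linarith [hx.1, (hm a).2]⟩
  have hbet : ∀ i a ω, |(H i a ω - m a) / c| ≤ 1 / c := fun i a ω ↦ by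
    rw [abs_div, abs_of_pos hc0]
    gcongr
    exact hdev a _ (hHval i a ω)
  have hincr : ∀ i a ω, |(if A i ω = a then (1 : ℝ) else 0) * (X i ω - m a)| ≤ 1 :=
    fun i a ω ↦ by
      split_ifs
      · simpa using hdev a _ (hXval i ω)
      · simp
  have hbound : ∀ a i ω, |D a i ω| ≤ 1 / c := fun a i ω ↦ by
    rw [hDdef, abs_mul, ← mul_one (1 / c)]
    exact mul_le_mul (hbet i a ω) (hincr i a ω) (abs_nonneg _) (by positivity)
  have hincr_meas : ∀ i a, StronglyMeasurable[ℱ (i + 1)]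
      fun ω ↦ (if A i ω = a then (1 : ℝ) else 0) * (X i ω - m a) := fun i a ↦
    (StronglyMeasurable.ite (hAmeas i (measurableSet_singleton a)) stronglyMeasurable_const
      stronglyMeasurable_const).mul ((hXmeas i).sub stronglyMeasurable_const)
  have hbet_meas : ∀ i a, StronglyMeasurable[ℱ i] fun ω ↦ (H i a ω - m a) / c := fun i a ↦
    ((hHmeas i a).sub stronglyMeasurable_const).div stronglyMeasurable_const
  have hD : ∀ a i, StronglyMeasurable[ℱ (i + 1)] (D a i) := fun a i ↦
    ((hbet_meas i a).mono (ℱ.mono i.le_succ)).mul (hincr_meas i a)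
  have hcondD : ∀ a i, P[D a i | ℱ i] =ᵐ[P] 0 := fun a i ↦ by
    refine (condExp_mul_of_stronglyMeasurable_left (hbet_meas i a)
      (.of_bound ((hD a i).mono (ℱ.le _)).aestronglyMeasurable _ (ae_of_all _ (hbound a i)))
      (.of_bound ((hincr_meas i a).mono (ℱ.le _)).aestronglyMeasurable _
        (ae_of_all _ (hincr i a)))).trans ?_
    filter_upwards [hcond i a] with ω hω
    rw [Pi.mul_apply, hω, mul_zero, Pi.zero_apply]
  have hmart : Martingale E ℱ P := by
    have hEeq : E = (1 / (W : ℝ)) • ∑ a : Fin W,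
        fun t ω ↦ ∏ i ∈ Finset.range t, (1 + D a i ω) := by
      ext t ω
      simp [hE, hKD, Finset.sum_apply]
    rw [hEeq]
    exact (Finset.sum_induction _ (Martingale · ℱ P) (fun _ _ ↦ Martingale.add)
      (martingale_zero _ _ _)
      fun a _ ↦ martingale_prod_one_add (hD a) (hbound a) (hcondD a)).smul _
  have hnonneg : ∀ t ω, 0 ≤ E t ω := fun t ω ↦ by
    rw [hE]
    refine mul_nonneg (by positivity) (Finset.sum_nonneg fun a _ ↦ ?_)
    rw [hKD]
    refine Finset.prod_nonneg fun i _ ↦ ?_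
    simp only [hDdef]
    split_ifs
    · have h := neg_quarter_le_sub_mul_sub (hHval i a ω) (hXval i ω) (hm a)
      rw [one_mul, div_mul_eq_mul_div, ← neg_le_iff_add_nonneg', le_div_iff₀ hc0]
      linarith
    · simp
  have hzero : ∀ ω, E 0 ω = 1 := fun ω ↦ by
    have : (W : ℝ) ≠ 0 := by positivity
    simp [hE, hK, this]
  refine ⟨hmart, hnonneg, hzero, fun α hα ↦ ?_⟩
  simpa [hzero] using hmart.measure_exists_ge_le hnonneg (one_div_pos.2 hα.1)
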